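/- Let h : A → M be a hash function chosen uniformly at random from a (log m)-universal hash family, where A is a weighted set with total weight O(n) and maximum element weight Õ(n/m), and |M| = m ≥ n^δ for a constant δ ∈ (0,1). Then with probability at least 1 − (2^{1/δ} e / (δ log n))^{δ log n}, the maximum load max_{μ∈M} Σ_{a : h(a)=μ} w(a) is Õ(n/m). -/

import Mathlib

open Finset in
lemma esym_step {ι : Type} [DecidableEq ι] (T : Finset ι) (x : ι → ℝ) (j : ℕ) :
    ((j : ℝ) + 1) * ∑ s ∈ T.powersetCard (j + 1), ∏ a ∈ s, x a
      = ∑ s ∈ T.powersetCard j, (∏ a ∈ s, x a) * ∑ a ∈ T \ s, x a := by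
  have h1 : ((j : ℝ) + 1) * ∑ s ∈ T.powersetCard (j + 1), ∏ a ∈ s, x a
      = ∑ s ∈ T.powersetCard (j + 1), ∑ _a ∈ s, ∏ a ∈ s, x a := by
    rw [Finset.mul_sum]
    refine Finset.sum_congr rfl fun s hs => ?_
    rw [Finset.mem_powersetCard] at hs
    rw [Finset.sum_const, hs.2, nsmul_eq_mul]
    push_cast
    ring
  rw [h1]
  simp_rw [Finset.mul_sum]
  rw [Finset.sum_sigma', Finset.sum_sigma']
  refine Finset.sum_bij' (fun p _ => ⟨p.1.erase p.2, p.2⟩) (fun p _ => ⟨insert p.2 p.1, p.2⟩)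
    ?_ ?_ ?_ ?_ ?_
  · rintro ⟨s, a⟩ hp
    simp only [Finset.mem_sigma, Finset.mem_powersetCard, Finset.mem_sdiff] at hp ⊢
    refine ⟨⟨(Finset.erase_subset _ _).trans hp.1.1, ?_⟩, hp.1.1 hp.2, by simp⟩
    rw [Finset.card_erase_of_mem hp.2, hp.1.2]; rfl
  · rintro ⟨s, a⟩ hp
    simp only [Finset.mem_sigma, Finset.mem_powersetCard, Finset.mem_sdiff] at hp ⊢
    refine ⟨⟨Finset.insert_subset hp.2.1 hp.1.1, ?_⟩, by simp⟩
    rw [Finset.card_insert_of_notMem hp.2.2, hp.1.2]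
  · rintro ⟨s, a⟩ hp
    simp only [Finset.mem_sigma] at hp
    simp [Finset.insert_erase hp.2]
  · rintro ⟨s, a⟩ hp
    simp only [Finset.mem_sigma, Finset.mem_sdiff] at hp
    simp [Finset.erase_insert hp.2.2]
  · rintro ⟨s, a⟩ hp
    simp only [Finset.mem_sigma] at hp
    exact (Finset.prod_erase_mul s x hp.2).symm

lemma esym_nonneg {ι : Type} (T : Finset ι) (x : ι → ℝ) (hx : ∀ a, 0 ≤ x a) (j : ℕ) :
    0 ≤ ∑ s ∈ T.powersetCard j, ∏ a ∈ s, x a :=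
  Finset.sum_nonneg fun _ _ => Finset.prod_nonneg fun a _ => hx a

lemma esym_upper {ι : Type} [DecidableEq ι] (T : Finset ι) (x : ι → ℝ) (hx : ∀ a, 0 ≤ x a)
    (j : ℕ) :
    (j.factorial : ℝ) * ∑ s ∈ T.powersetCard j, ∏ a ∈ s, x a ≤ (∑ a ∈ T, x a) ^ j := by
  induction j with
  | zero => simp
  | succ j ih =>
    have hS : 0 ≤ ∑ a ∈ T, x a := Finset.sum_nonneg fun a _ => hx a
    have h2 : ((j : ℝ) + 1) * ∑ s ∈ T.powersetCard (j + 1), ∏ a ∈ s, x a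
        ≤ (∑ s ∈ T.powersetCard j, ∏ a ∈ s, x a) * ∑ a ∈ T, x a := by
      rw [esym_step, Finset.sum_mul]
      refine Finset.sum_le_sum fun s _ => ?_
      refine mul_le_mul_of_nonneg_left ?_ (Finset.prod_nonneg fun a _ => hx a)
      exact Finset.sum_le_sum_of_subset_of_nonneg Finset.sdiff_subset fun a _ _ => hx a
    rw [Nat.factorial_succ]
    push_cast
    calc ((j : ℝ) + 1) * (j.factorial : ℝ) * ∑ s ∈ T.powersetCard (j + 1), ∏ a ∈ s, x a
        = (j.factorial : ℝ) * (((j : ℝ) + 1) * ∑ s ∈ T.powersetCard (j + 1), ∏ a ∈ s, x a) := by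
          ring
      _ ≤ (j.factorial : ℝ) * ((∑ s ∈ T.powersetCard j, ∏ a ∈ s, x a) * ∑ a ∈ T, x a) :=
          mul_le_mul_of_nonneg_left h2 (by positivity)
      _ = ((j.factorial : ℝ) * ∑ s ∈ T.powersetCard j, ∏ a ∈ s, x a) * ∑ a ∈ T, x a := by ring
      _ ≤ (∑ a ∈ T, x a) ^ j * ∑ a ∈ T, x a := mul_le_mul_of_nonneg_right ih hS
      _ = _ := by ring

lemma esym_lower {ι : Type} [DecidableEq ι] (T : Finset ι) (x : ι → ℝ) (hx : ∀ a, 0 ≤ x a)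
    (W R : ℝ) (hW0 : 0 ≤ W) (hR : 0 ≤ R) (hW : ∀ a ∈ T, x a ≤ W) (k : ℕ)
    (hS : R + k * W ≤ ∑ a ∈ T, x a) (j : ℕ) (hj : j ≤ k) :
    R ^ j ≤ (j.factorial : ℝ) * ∑ s ∈ T.powersetCard j, ∏ a ∈ s, x a := by
  induction j with
  | zero => simp
  | succ j ih =>
    have ih := ih (by omega)
    have h2 : (∑ s ∈ T.powersetCard j, ∏ a ∈ s, x a) * R
        ≤ ((j : ℝ) + 1) * ∑ s ∈ T.powersetCard (j + 1), ∏ a ∈ s, x a := by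
      rw [esym_step, Finset.sum_mul]
      refine Finset.sum_le_sum fun s hs => ?_
      refine mul_le_mul_of_nonneg_left ?_ (Finset.prod_nonneg fun a _ => hx a)
      rw [Finset.mem_powersetCard] at hs
      have e := Finset.sum_sdiff (f := x) hs.1
      have e2 : ∑ a ∈ s, x a ≤ j * W := by
        have := Finset.sum_le_card_nsmul s x W (fun a ha => hW a (hs.1 ha))
        rwa [hs.2, nsmul_eq_mul] at this
      have e3 : (j : ℝ) * W ≤ k * W := by
        refine mul_le_mul_of_nonneg_right ?_ hW0
        exact_mod_cast (by omega : j ≤ k)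
      linarith
    rw [Nat.factorial_succ]
    push_cast
    calc R ^ (j + 1) = R ^ j * R := by ring
      _ ≤ ((j.factorial : ℝ) * ∑ s ∈ T.powersetCard j, ∏ a ∈ s, x a) * R :=
          mul_le_mul_of_nonneg_right ih hR
      _ = (j.factorial : ℝ) * ((∑ s ∈ T.powersetCard j, ∏ a ∈ s, x a) * R) := by ring
      _ ≤ (j.factorial : ℝ) * (((j : ℝ) + 1) * ∑ s ∈ T.powersetCard (j + 1), ∏ a ∈ s, x a) :=
          mul_le_mul_of_nonneg_left h2 (by positivity)
      _ = _ := by ring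

lemma moment {ι : Type} [DecidableEq ι] {m : ℕ} (A : Finset ι) (x : ι → ℝ)
    (H : Finset (ι → Fin m)) (j : ℕ) (b : Fin m)
    (hu : ∀ s : Finset ι, s ⊆ A → s.card = j →
      (H.filter fun h => ∀ a ∈ s, h a = b).card * m ^ j = H.card) :
    (∑ h ∈ H, ∑ s ∈ (A.filter fun y => h y = b).powersetCard j, ∏ a ∈ s, x a) * (m : ℝ) ^ j
      = H.card * ∑ s ∈ A.powersetCard j, ∏ a ∈ s, x a := by
  have h1 : ∀ h ∈ H, ∑ s ∈ (A.filter fun y => h y = b).powersetCard j, ∏ a ∈ s, x a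
      = ∑ s ∈ A.powersetCard j, if (∀ a ∈ s, h a = b) then ∏ a ∈ s, x a else 0 := by
    intro h _
    rw [← Finset.sum_filter]
    refine Finset.sum_congr ?_ fun _ _ => rfl
    ext s
    simp only [Finset.mem_powersetCard, Finset.mem_filter, Finset.subset_iff]
    constructor
    · rintro ⟨h1, h2⟩
      exact ⟨⟨fun a ha => (h1 ha).1, h2⟩, fun a ha => (h1 ha).2⟩
    · rintro ⟨⟨h1, h2⟩, h3⟩
      exact ⟨fun a ha => ⟨h1 ha, h3 a ha⟩, h2⟩
  rw [Finset.sum_congr rfl h1, Finset.sum_comm, Finset.sum_mul, Finset.mul_sum]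
  refine Finset.sum_congr rfl fun s hs => ?_
  rw [Finset.mem_powersetCard] at hs
  rw [← Finset.sum_filter, Finset.sum_const, nsmul_eq_mul, ← hu s hs.1 hs.2]
  push_cast
  ring

lemma bad_bin {ι : Type} [DecidableEq ι] {m : ℕ} (A : Finset ι) (x : ι → ℝ)
    (hx : ∀ a, 0 ≤ x a)
    (H : Finset (ι → Fin m)) (j : ℕ) (b : Fin m)
    (hu : ∀ s : Finset ι, s ⊆ A → s.card = j →
      (H.filter fun h => ∀ a ∈ s, h a = b).card * m ^ j = H.card)
    (W R N : ℝ) (hW0 : 0 ≤ W) (hR : 0 ≤ R) (hW : ∀ a ∈ A, x a ≤ W)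
    (hN : ∑ a ∈ A, x a ≤ N)
    (B : Finset (ι → Fin m)) (hBH : B ⊆ H)
    (hB : ∀ h ∈ B, R + j * W ≤ ∑ a ∈ A.filter (fun y => h y = b), x a) :
    (B.card : ℝ) * (R * m) ^ j ≤ H.card * N ^ j := by
  have hm := moment A x H j b hu
  have h1 : (B.card : ℝ) * R ^ j ≤ (j.factorial : ℝ) *
      ∑ h ∈ H, ∑ s ∈ (A.filter fun y => h y = b).powersetCard j, ∏ a ∈ s, x a := by
    calc (B.card : ℝ) * R ^ j = ∑ h ∈ B, R ^ j := by rw [Finset.sum_const, nsmul_eq_mul]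
      _ ≤ ∑ h ∈ B, (j.factorial : ℝ) *
          ∑ s ∈ (A.filter fun y => h y = b).powersetCard j, ∏ a ∈ s, x a :=
          Finset.sum_le_sum fun h hh => esym_lower _ x hx W R hW0 hR
            (fun a ha => hW a (Finset.mem_filter.1 ha).1) j (hB h hh) j le_rfl
      _ ≤ ∑ h ∈ H, (j.factorial : ℝ) *
          ∑ s ∈ (A.filter fun y => h y = b).powersetCard j, ∏ a ∈ s, x a :=
          Finset.sum_le_sum_of_subset_of_nonneg hBH fun h _ _ =>
            mul_nonneg (by positivity) (esym_nonneg _ x hx j)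
      _ = _ := by rw [Finset.mul_sum]
  have h2 := esym_upper A x hx j
  have h3 : (∑ a ∈ A, x a) ^ j ≤ N ^ j :=
    pow_le_pow_left₀ (Finset.sum_nonneg fun a _ => hx a) hN j
  calc (B.card : ℝ) * (R * m) ^ j = (B.card : ℝ) * R ^ j * (m : ℝ) ^ j := by rw [mul_pow]; ring
    _ ≤ (j.factorial : ℝ) *
      (∑ h ∈ H, ∑ s ∈ (A.filter fun y => h y = b).powersetCard j, ∏ a ∈ s, x a) * (m : ℝ) ^ j :=
        mul_le_mul_of_nonneg_right h1 (by positivity)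
    _ = H.card * ((j.factorial : ℝ) * ∑ s ∈ A.powersetCard j, ∏ a ∈ s, x a) := by
        rw [mul_assoc, hm]; ring
    _ ≤ H.card * N ^ j := mul_le_mul_of_nonneg_left (h2.trans h3) (by positivity)

lemma prob_bound (δ L n m : ℝ) (c₀ j : ℕ) (hδ0 : 0 < δ) (hδ1 : δ < 1) (hL : 2 ≤ L)
    (hn : 0 < n) (hnL : (2 : ℝ) ^ L = n) (hx : 2 ≤ δ * L) (hj : δ * L < j + 1)
    (hc₀ : 0 < c₀) (hm : m ≤ c₀ * n * L ^ c₀) :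
    m ≤ (2 ^ (1/δ) * Real.exp 1 / (δ * L)) ^ (δ * L) * (L ^ (2 * c₀ + 2)) ^ j := by
  have hL0 : 0 < L := by linarith
  have hb : (2 : ℝ) ^ (1/δ) / L ≤ 2 ^ (1/δ) * Real.exp 1 / (δ * L) := by
    rw [div_le_div_iff₀ hL0 (by positivity)]
    have h2 : (0 : ℝ) < 2 ^ (1/δ) := by positivity
    have he : δ ≤ Real.exp 1 := by
      have := Real.add_one_le_exp (1 : ℝ)
      linarith
    have : (2 : ℝ) ^ (1/δ) * L * δ ≤ (2 : ℝ) ^ (1/δ) * L * Real.exp 1 :=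
      mul_le_mul_of_nonneg_left he (by positivity)
    linarith
  have hp : n * L ^ (-(δ * L)) ≤ (2 ^ (1/δ) * Real.exp 1 / (δ * L)) ^ (δ * L) := by
    refine le_trans (le_of_eq ?_) (Real.rpow_le_rpow (by positivity) hb (by positivity))
    rw [Real.div_rpow (by positivity) hL0.le, ← Real.rpow_mul (by norm_num),
      show 1 / δ * (δ * L) = L by field_simp, hnL, Real.rpow_neg hL0.le]
    rfl
  have hc : (c₀ : ℝ) ≤ L ^ c₀ := by
    calc (c₀ : ℝ) ≤ 2 ^ c₀ := by exact_mod_cast (Nat.lt_two_pow_self).le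
      _ ≤ L ^ c₀ := pow_le_pow_left₀ (by norm_num) hL _
  have hc1 : (1 : ℝ) ≤ c₀ := by exact_mod_cast hc₀
  have hexp : (2 * c₀ : ℝ) ≤ -(δ * L) + ((2 * c₀ + 2) * j : ℝ) := by
    nlinarith
  have hfin : (L ^ c₀ * L ^ c₀ : ℝ) ≤ L ^ (-(δ * L)) * (L ^ (2 * c₀ + 2)) ^ j := by
    have e1 : (L ^ c₀ * L ^ c₀ : ℝ) = L ^ (2 * c₀ : ℝ) := by
      rw [← pow_add, ← Real.rpow_natCast]; congr 1; push_cast; ring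
    have e2 : ((L ^ (2 * c₀ + 2)) ^ j : ℝ) = L ^ ((2 * c₀ + 2) * j : ℝ) := by
      rw [← pow_mul, ← Real.rpow_natCast]; congr 1; push_cast; ring
    rw [e1, e2, ← Real.rpow_add hL0]
    exact Real.rpow_le_rpow_of_exponent_le (by linarith) hexp
  calc m ≤ c₀ * n * L ^ c₀ := hm
    _ = n * (c₀ * L ^ c₀) := by ring
    _ ≤ n * (L ^ c₀ * L ^ c₀) := by gcongr
    _ ≤ n * (L ^ (-(δ * L)) * (L ^ (2 * c₀ + 2)) ^ j) := by gcongr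
    _ = n * L ^ (-(δ * L)) * (L ^ (2 * c₀ + 2)) ^ j := by ring
    _ ≤ _ := by gcongr

/-- Let `h : A → M` be chosen uniformly at random from a `(log m)`-universal hash
family `H`, where `A` is a weighted set with total weight `O(n)` and maximum element
weight `Õ(n/m)`, and the number of machines satisfies `|M| = m ≥ n^δ` for a constant
`δ ∈ (0,1)`.  Then with probability at least
`1 − (2^(1/δ)·e/(δ·log n))^(δ·log n)` the maximum load
`max_{μ ∈ M} Σ_{a : h(a) = μ} w(a)` is `Õ(n/m)`.
`(log m)`-universality is expressed combinatorially: for any set `s` of at most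
`log₂ m` keys and any target values, exactly a `m^{-|s|}` fraction of the family
agrees with the targets on `s`. -/
theorem universal_hash_max_load :
    ∀ (δ : ℝ), 0 < δ → δ < 1 →
    ∀ (c₀ : ℕ), 0 < c₀ →
    ∃ (c : ℕ), 0 < c ∧
      ∀ (n m : ℕ) (ι : Type) (_ : DecidableEq ι)
        (A : Finset ι) (w : ι → ℕ) (H : Finset (ι → Fin m)),
        2 ≤ n → 0 < m → (n : ℝ) ^ δ ≤ (m : ℝ) → H.Nonempty →
        -- (log m)-universality of the family H
        (∀ s : Finset ι, s ⊆ A → s.card ≤ Nat.log 2 m → ∀ f : ι → Fin m,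
          (H.filter fun h => ∀ a ∈ s, h a = f a).card * m ^ s.card = H.card) →
        -- total weight O(n)
        (∑ a ∈ A, w a) ≤ c₀ * n →
        -- maximum element weight Õ(n/m)
        (∀ a ∈ A, (w a : ℝ) * (m : ℝ) ≤ c₀ * (n : ℝ) * Real.logb 2 n ^ c₀) →
        -- with the stated probability, the maximum load is Õ(n/m)
        (1 - (2 ^ (1/δ) * Real.exp 1 / (δ * Real.logb 2 n)) ^ (δ * Real.logb 2 n))
            * (H.card : ℝ)
          ≤ ({h : ι → Fin m | h ∈ H ∧ ∀ b : Fin m,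
                ((∑ a ∈ A.filter fun x => h x = b, w a : ℕ) : ℝ)
                  ≤ (c : ℝ) * ((n : ℝ) / (m : ℝ)) * Real.logb 2 n ^ c}.ncard : ℝ) := by
  intro δ hδ0 hδ1 c₀ hc₀
  refine ⟨2 * c₀ + 2, by omega, ?_⟩
  intro n m ι _ A w H hn hm hnm hH hu htot hmax
  classical
  set L := Real.logb 2 n with hLdef
  have hn2 : (2 : ℝ) ≤ n := by exact_mod_cast hn
  have hn0 : (0 : ℝ) < n := by linarith
  have hm0 : (0 : ℝ) < m := by exact_mod_cast hm
  have hL1 : 1 ≤ L := by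
    rw [hLdef, Real.le_logb_iff_rpow_le (by norm_num) hn0]; simpa using hn2
  have hL0 : 0 < L := by linarith
  have hnL : (2 : ℝ) ^ L = n := Real.rpow_logb (by norm_num) (by norm_num) hn0
  have hx0 : 0 < δ * L := by positivity
  set p := (2 ^ (1/δ) * Real.exp 1 / (δ * L)) ^ (δ * L) with hp
  have hp0 : 0 ≤ p := by positivity
  have hHc : (0 : ℝ) ≤ H.card := by positivity
  by_cases hbig : δ * L ≤ 2 ^ (1/δ) * Real.exp 1
  · have : 1 ≤ p := Real.one_le_rpow ((one_le_div hx0).2 hbig) hx0.le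
    refine le_trans ?_ (Nat.cast_nonneg _)
    exact mul_nonpos_of_nonpos_of_nonneg (by linarith) hHc
  push Not at hbig
  have hx2 : 2 ≤ δ * L := by
    have h1 : (1 : ℝ) ≤ 2 ^ (1/δ) := Real.one_le_rpow (by norm_num) (by positivity)
    have h2 := Real.add_one_le_exp (1 : ℝ)
    nlinarith
  have hL2 : 2 ≤ L := by nlinarith
  set Q : (ι → Fin m) → Fin m → Prop := fun h b =>
    ((∑ a ∈ A.filter fun x => h x = b, w a : ℕ) : ℝ)
      ≤ ((2 * c₀ + 2 : ℕ) : ℝ) * ((n : ℝ) / (m : ℝ)) * L ^ (2 * c₀ + 2) with hQ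
  have hset : {h : ι → Fin m | h ∈ H ∧ ∀ b : Fin m, Q h b}
      = ((H.filter fun h => ∀ b, Q h b : Finset (ι → Fin m)) : Set (ι → Fin m)) := by
    ext h; simp
  change (1 - p) * (H.card : ℝ) ≤ (({h : ι → Fin m | h ∈ H ∧ ∀ b : Fin m, Q h b}.ncard : ℕ) : ℝ)
  rw [hset, Set.ncard_coe_finset]
  by_cases hw : ∀ a ∈ A, w a = 0
  · have : (H.filter fun h => ∀ b, Q h b) = H := by
      refine Finset.filter_true_of_mem fun h _ b => ?_
      simp only [hQ]
      rw [Finset.sum_eq_zero fun a ha => hw a (Finset.mem_filter.1 ha).1]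
      push_cast
      positivity
    rw [this]
    nlinarith
  push Not at hw
  obtain ⟨a₀, ha₀, hwa₀⟩ := hw
  have hmn : (m : ℝ) ≤ c₀ * n * L ^ c₀ := by
    refine le_trans ?_ (hmax a₀ ha₀)
    have : (1 : ℝ) ≤ w a₀ := by exact_mod_cast Nat.one_le_iff_ne_zero.2 hwa₀
    nlinarith
  set j := ⌊δ * L⌋₊ with hj
  have hj1 : δ * L < j + 1 := Nat.lt_floor_add_one _
  have hj2 : (j : ℝ) ≤ δ * L := Nat.floor_le hx0.le
  have hjL : (j : ℝ) ≤ L := by nlinarith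
  have hjm : j ≤ Nat.log 2 m := by
    rw [Nat.le_log_iff_pow_le (by norm_num) hm.ne']
    have : ((2 : ℝ) ^ j) ≤ m := by
      refine le_trans ?_ hnm
      rw [← hnL, ← Real.rpow_mul (by norm_num), ← Real.rpow_natCast]
      exact Real.rpow_le_rpow_of_exponent_le (by norm_num) (by linarith)
    exact_mod_cast this
  have hprob := prob_bound δ L n m c₀ j hδ0 hδ1 hL2 hn0 hnL hx2 hj1 hc₀ hmn
  rw [← hp] at hprob
  have hc1 : (1 : ℝ) ≤ c₀ := by exact_mod_cast hc₀
  set D := L ^ (2 * c₀ + 2) with hD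
  have hD0 : 0 < D := by positivity
  have hbin : ∀ b : Fin m, ((H.filter fun h => ¬ Q h b).card : ℝ) * D ^ j ≤ H.card := by
    intro b
    have key := bad_bin A (fun a => (w a : ℝ)) (fun a => by positivity) H j b
      (fun s hs hsj => by
        have := hu s hs (by omega) (fun _ => b)
        rwa [hsj] at this)
      (c₀ * n * L ^ c₀ / m) (c₀ * n * D / m) (c₀ * n) (by positivity) (by positivity)
      (fun a ha => by rw [le_div_iff₀ hm0]; exact hmax a ha)
      (by exact_mod_cast htot)
      (H.filter fun h => ¬ Q h b) (Finset.filter_subset _ _)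
      (fun h hh => by
        have h1 := (Finset.mem_filter.1 hh).2
        simp only [hQ, not_le] at h1
        push_cast at h1
        refine le_trans ?_ h1.le
        have h2 : (j : ℝ) * L ^ c₀ ≤ D := by
          calc (j : ℝ) * L ^ c₀ ≤ L * L ^ c₀ := by gcongr
            _ = L ^ (c₀ + 1) := by ring
            _ ≤ D := pow_le_pow_right₀ hL1 (by omega)
        have h3 : (n : ℝ) / m * c₀ * (j * L ^ c₀) ≤ (n : ℝ) / m * c₀ * D := by gcongr
        have h4 : 0 ≤ (n : ℝ) / m * D := by positivity
        calc c₀ * n * D / m + j * (c₀ * n * L ^ c₀ / m)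
            = n / m * c₀ * D + (n : ℝ) / m * c₀ * (j * L ^ c₀) := by ring
          _ ≤ n / m * c₀ * D + (n : ℝ) / m * c₀ * D + 2 * (n / m * D) := by linarith
          _ = _ := by ring)
    have e : c₀ * n * D / m * (m : ℝ) = c₀ * n * D := by field_simp
    rw [e, mul_pow _ D] at key
    have hpos : 0 < ((c₀ : ℝ) * n) ^ j := by positivity
    refine le_of_mul_le_mul_right ?_ hpos
    linarith
  have hbad : ((H.filter fun h => ¬ ∀ b, Q h b).card : ℝ) * D ^ j ≤ m * H.card := by
    have hsub : (H.filter fun h => ¬ ∀ b, Q h b)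
        ⊆ Finset.univ.biUnion fun b => H.filter fun h => ¬ Q h b := by
      intro h hh
      rw [Finset.mem_filter] at hh
      obtain ⟨b, hb⟩ := not_forall.1 hh.2
      exact Finset.mem_biUnion.2 ⟨b, Finset.mem_univ _, Finset.mem_filter.2 ⟨hh.1, hb⟩⟩
    have h1 : ((H.filter fun h => ¬ ∀ b, Q h b).card : ℝ)
        ≤ ∑ b : Fin m, ((H.filter fun h => ¬ Q h b).card : ℝ) := by
      exact_mod_cast (Finset.card_le_card hsub).trans Finset.card_biUnion_le
    calc _ ≤ (∑ b : Fin m, ((H.filter fun h => ¬ Q h b).card : ℝ)) * D ^ j := by gcongr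
      _ = ∑ b : Fin m, ((H.filter fun h => ¬ Q h b).card : ℝ) * D ^ j := by rw [Finset.sum_mul]
      _ ≤ ∑ _b : Fin m, (H.card : ℝ) := Finset.sum_le_sum fun b _ => hbin b
      _ = m * H.card := by simp
  have hbad2 : ((H.filter fun h => ¬ ∀ b, Q h b).card : ℝ) ≤ p * H.card := by
    refine le_of_mul_le_mul_right (hbad.trans ?_) (pow_pos hD0 j)
    calc (m : ℝ) * H.card ≤ p * D ^ j * H.card := by gcongr
      _ = _ := by ring
  have hsplit : ((H.filter fun h => ∀ b, Q h b).card : ℝ)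
      + ((H.filter fun h => ¬ ∀ b, Q h b).card : ℝ) = H.card := by
    exact_mod_cast Finset.card_filter_add_card_filter_not (s := H) (fun h => ∀ b, Q h b)
  linarith
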